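/- Let H be an elementary abelian 2-hypergroup and G a closed subset of H. Then there is a unique r ∈ G such that Thick(G) = ⟨r⟩ and s(G) = s(r). -/

import Mathlib

namespace HyperPaper

/-- A hypergroup: hypermultiplication `hmul`, inversion `star`, identity `e`,
satisfying (H1) associativity, (H2) unique two-sided identity, (H3) exchange conditions. -/
structure Hypergroup (H : Type*) where
  hmul : H → H → Set H
  star : H → H
  e : H
  idl : ∀ p, hmul e p = {p}
  idr : ∀ p, hmul p e = {p}
  e_unique : ∀ e' : H, (∀ p, hmul e' p = {p} ∧ hmul p e' = {p}) → e' = e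
  assoc : ∀ p q r : H, (⋃ x ∈ hmul p q, hmul x r) = ⋃ x ∈ hmul q r, hmul p x
  h3l : ∀ p q r : H, p ∈ hmul q r ↔ q ∈ hmul p (star r)
  h3r : ∀ p q r : H, p ∈ hmul q r ↔ r ∈ hmul (star q) p

variable {H : Type*}

namespace Hypergroup

/-- Product of two subsets: FG = {a : ∃ b ∈ F, c ∈ G, a ∈ bc}. -/
def smul (hg : Hypergroup H) (F G : Set H) : Set H :=
  {a | ∃ b ∈ F, ∃ c ∈ G, a ∈ hg.hmul b c}

/-- Closed subset: nonempty and G*G ⊆ G. -/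
def IsClosed (hg : Hypergroup H) (G : Set H) : Prop :=
  G.Nonempty ∧ hg.smul (hg.star '' G) G ⊆ G

/-- Thin element: p*p = {e}. -/
def IsThin (hg : Hypergroup H) (p : H) : Prop := hg.hmul (hg.star p) p = {hg.e}

/-- Thick element: not thin. -/
def IsThick (hg : Hypergroup H) (p : H) : Prop := ¬ hg.IsThin p

/-- Involution: p ≠ e and {e, p} is closed. -/
def IsInvolution (hg : Hypergroup H) (p : H) : Prop :=
  p ≠ hg.e ∧ hg.IsClosed {hg.e, p}

/-- ⟨G⟩: smallest closed subset containing G. -/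
def gen (hg : Hypergroup H) (G : Set H) : Set H := ⋂₀ {C | hg.IsClosed C ∧ G ⊆ C}

/-- O_ϑ(G): the thin elements of H lying in G. -/
def Othin (hg : Hypergroup H) (G : Set H) : Set H := {p ∈ G | hg.IsThin p}

/-- F is a strongly normal closed subset of G: p*Fp ⊆ F ⊆ G for all p ∈ G. -/
def IsStronglyNormal (hg : Hypergroup H) (F G : Set H) : Prop :=
  hg.IsClosed F ∧ hg.IsClosed G ∧ F ⊆ G ∧
    ∀ p ∈ G, hg.smul (hg.smul {hg.star p} F) {p} ⊆ F

/-- O^ϑ(G): intersection of all strongly normal closed subsets of ⟨G⟩. -/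
def Osup (hg : Hypergroup H) (G : Set H) : Set H :=
  ⋂₀ {F | hg.IsStronglyNormal F (hg.gen G)}

/-- F is a normal closed subset of G. -/
def IsNormal (hg : Hypergroup H) (F G : Set H) : Prop :=
  hg.IsClosed F ∧ hg.IsClosed G ∧ F ⊆ G ∧ ∀ p ∈ G, hg.smul F {p} = hg.smul {p} F

/-- Product of a list of subsets (empty product is {e}). -/
def listProd (hg : Hypergroup H) : List (Set H) → Set H
  | [] => {hg.e}
  | a :: l => hg.smul a (hg.listProd l)

/-- Product r_1 r_2 ⋯ r_n of a family of elements. -/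
def famProd (hg : Hypergroup H) {n : ℕ} (r : Fin n → H) : Set H :=
  hg.listProd ((List.finRange n).map fun i => ({r i} : Set H))

/-- Ĝ_i: the product of the G_j with j ≠ i. -/
def cofactor (hg : Hypergroup H) {n : ℕ} (G : Fin n → Set H) (i : Fin n) : Set H :=
  hg.listProd (((List.finRange n).filter fun j => decide (j ≠ i)).map G)

/-- H is the direct product of the normal closed subsets G_1, …, G_n. -/
def IsDirectProduct (hg : Hypergroup H) {n : ℕ} (G : Fin n → Set H) : Prop :=
  (∀ i, hg.IsNormal (G i) Set.univ) ∧
  (∀ i, hg.smul (G i) (hg.cofactor G i) = Set.univ) ∧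
  (∀ i, G i ∩ hg.cofactor G i = {hg.e})

/-- r : Fin n → H is a decomposition of x with respect to the family G. -/
def IsDecomp (hg : Hypergroup H) {n : ℕ} (G : Fin n → Set H) (x : H) (r : Fin n → H) : Prop :=
  (∀ i, r i ∈ G i) ∧ x ∈ hg.famProd r

/-- The support of x: the elements ≠ e appearing in the decomposition of x. -/
def dsupport (hg : Hypergroup H) {n : ℕ} (G : Fin n → Set H) (x : H) : Set H :=
  {y | y ≠ hg.e ∧ ∃ r, hg.IsDecomp G x r ∧ y ∈ Set.range r}

/-- The cover of x: the product r_1r_2⋯r_n for the decomposition of x. -/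
def dcover (hg : Hypergroup H) {n : ℕ} (G : Fin n → Set H) (x : H) : Set H :=
  {y | ∃ r, hg.IsDecomp G x r ∧ y ∈ hg.famProd r}

/-- x is constrained: its cover equals {x}. -/
def IsConstrained (hg : Hypergroup H) {n : ℕ} (G : Fin n → Set H) (x : H) : Prop :=
  hg.dcover G x = {x}

/-- r_2(G): the largest 2-rank of a thin closed subset of H contained in G
(equivalently, the largest k such that G contains a thin symmetric closed subset
of 2^k elements, which corresponds to an elementary abelian 2-group of 2-rank k). -/
noncomputable def rank2 (hg : Hypergroup H) (G : Set H) : ℕ :=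
  sSup {k | ∃ U : Set H, hg.IsClosed U ∧ U ⊆ G ∧ (∀ u ∈ U, hg.IsThin u) ∧
    (∀ u ∈ U, hg.star u = u) ∧ U.ncard = 2 ^ k}

/-- F is a minimal generating subset of G. -/
def IsMinGen (hg : Hypergroup H) (G F : Set H) : Prop :=
  F ⊆ G ∧ hg.gen F = G ∧ ∀ p ∈ F, hg.gen (F \ {p}) ≠ G

/-- The dimension of G: the smallest cardinality of a minimal generating subset. -/
noncomputable def dimension (hg : Hypergroup H) (G : Set H) : ℕ :=
  sInf {k | ∃ F : Set H, hg.IsMinGen G F ∧ F.Finite ∧ F.ncard = k}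

/-- [F, G] = ⟨{a : ∃ b ∈ F, c ∈ G, a ∈ b*c*bc}⟩. -/
def commSet (hg : Hypergroup H) (F G : Set H) : Set H :=
  hg.gen {a | ∃ b ∈ F, ∃ c ∈ G,
    a ∈ hg.smul (hg.smul (hg.smul {hg.star b} {hg.star c}) {b}) {c}}

/-- derived G k = G^{(k+1)}: G^{(1)} = G, G^{(r)} = [G^{(r-1)}, G]. -/
def derived (hg : Hypergroup H) (G : Set H) : ℕ → Set H
  | 0 => G
  | k + 1 => hg.commSet (hg.derived G k) G

/-- G is nilpotent: G^{(r)} = {e} for some r. -/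
def IsNilpotent (hg : Hypergroup H) (G : Set H) : Prop :=
  ∃ k : ℕ, hg.derived G k = {hg.e}

/-- G is a residually thin closed subset: there is a chain {e} = F_1, …, F_n = G of
pairwise distinct closed subsets, each strongly normal in the next. -/
def IsResiduallyThin (hg : Hypergroup H) (G : Set H) : Prop :=
  ∃ (m : ℕ) (F : Fin (m + 1) → Set H), Function.Injective F ∧
    F 0 = {hg.e} ∧ F (Fin.last m) = G ∧
    ∀ i : Fin m, hg.IsStronglyNormal (F i.castSucc) (F i.succ)

/-- x^k as a subset: x^0 = {e}, x^{k+1} = x^k · x. -/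
def spow (hg : Hypergroup H) (x : H) : ℕ → Set H
  | 0 => {hg.e}
  | k + 1 => hg.smul (hg.spow x k) {x}

/-- F is a maximal closed subset of G. -/
def IsMaximalClosed (hg : Hypergroup H) (F G : Set H) : Prop :=
  hg.IsClosed F ∧ hg.IsClosed G ∧ F ⊆ G ∧ F ≠ G ∧
    ∀ E : Set H, hg.IsClosed E → F ⊆ E → E ⊆ G → E = F ∨ E = G

/-- The Frattini closed subset of G: the intersection (inside G) of all maximal
closed subsets of G. -/
def frattini (hg : Hypergroup H) (G : Set H) : Set H :=
  G ∩ ⋂₀ {F | hg.IsMaximalClosed F G}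

/-- α is an isomorphism from the closed subset F to the closed subset G. -/
def IsIso (hg : Hypergroup H) (F G : Set H) (α : H → H) : Prop :=
  Set.BijOn α F G ∧ α hg.e = hg.e ∧
    ∀ p ∈ F, ∀ q ∈ F, α '' hg.hmul p q = hg.hmul (α p) (α q)

/-- F ≃ G: there is an isomorphism from F to G. -/
def Isomorphic (hg : Hypergroup H) (F G : Set H) : Prop := ∃ α : H → H, hg.IsIso F G α

/-- Aut(G): the automorphism group of G, realized as the subgroup of permutations of G
that fix e and preserve the hypermultiplication. -/
def autGroup (hg : Hypergroup H) (G : Set H) : Subgroup (Equiv.Perm G) where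
  carrier := {σ | (∀ x : G, (x : H) = hg.e → ((σ x : H)) = hg.e) ∧
    ∀ p q x : G, (x : H) ∈ hg.hmul p q ↔ ((σ x : H)) ∈ hg.hmul (σ p) (σ q)}
  one_mem' := by
    constructor
    · intro x hx; simpa using hx
    · intro p q x; simp
  mul_mem' := by
    rintro σ τ ⟨he1, hm1⟩ ⟨he2, hm2⟩
    refine ⟨fun x hx => ?_, fun p q x => ?_⟩
    · simpa using he1 _ (he2 x hx)
    · simpa using (hm2 p q x).trans (hm1 (τ p) (τ q) (τ x))
  inv_mem' := by
    rintro σ ⟨he, hm⟩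
    refine ⟨fun x hx => ?_, fun p q x => ?_⟩
    · have h2 : σ x = x := Subtype.ext ((he x hx).trans hx.symm)
      have h3 : σ⁻¹ x = x := by
        conv_lhs => rw [← h2]
        simp
      rw [h3]; exact hx
    · have h := hm (σ⁻¹ p) (σ⁻¹ q) (σ⁻¹ x)
      simpa using h.symm

end Hypergroup

/-- An elementary abelian 2-hypergroup: a hypergroup that is the constrained direct
product of the closed subsets ⟨q_1⟩, …, ⟨q_n⟩ generated by involutions q_1, …, q_n. -/
structure EA2Data (H : Type*) where
  hg : Hypergroup H
  n : ℕ
  q : Fin n → H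
  invol : ∀ i, hg.IsInvolution (q i)
  dp : hg.IsDirectProduct fun i => hg.gen {q i}
  constrained : ∀ x : H, hg.IsConstrained (fun i => hg.gen {q i}) x

namespace EA2Data

/-- The family ⟨q_1⟩, …, ⟨q_n⟩. -/
def fam (E : EA2Data H) : Fin E.n → Set H := fun i => E.hg.gen {E.q i}

/-- The support of x. -/
def support (E : EA2Data H) (x : H) : Set H := E.hg.dsupport E.fam x

/-- Thick(F): externally thick elements of H lying in F. -/
def ThickIn (E : EA2Data H) (F : Set H) : Set H :=
  {x ∈ F | x = E.hg.e ∨ ∀ y ∈ E.support x, E.hg.IsThick y}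

/-- Thin(F): externally thin elements of H lying in F. -/
def ThinIn (E : EA2Data H) (F : Set H) : Set H :=
  {x ∈ F | x = E.hg.e ∨ ∀ y ∈ E.support x, E.hg.IsThin y}

/-- The (unique) pair (x⁺, x⁻) with x⁺ ∈ Thick(H), x⁻ ∈ Thin(H), x⁺x⁻ = {x}. -/
noncomputable def pm (E : EA2Data H) (x : H) : H × H :=
  @Classical.epsilon (H × H) ⟨(E.hg.e, E.hg.e)⟩ fun z =>
    z.1 ∈ E.ThickIn Set.univ ∧ z.2 ∈ E.ThinIn Set.univ ∧ E.hg.hmul z.1 z.2 = {x}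

/-- x⁺. -/
noncomputable def plus (E : EA2Data H) (x : H) : H := (E.pm x).1

/-- x⁻. -/
noncomputable def minus (E : EA2Data H) (x : H) : H := (E.pm x).2

/-- s(x): the number of thick elements of H in the support of x. -/
noncomputable def sElem (E : EA2Data H) (x : H) : ℕ :=
  {y ∈ E.support x | E.hg.IsThick y}.ncard

/-- s(G) = max {s(a) : a ∈ G}. -/
noncomputable def sSet (E : EA2Data H) (G : Set H) : ℕ :=
  sSup {k | ∃ a ∈ G, E.sElem a = k}

/-- x ⪯ y: the support of x is contained in the support of y. -/
def ple (E : EA2Data H) (x y : H) : Prop := E.support x ⊆ E.support y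

/-- p♯: the number of thick elements among q_1, …, q_n. -/
noncomputable def psharp (E : EA2Data H) : ℕ := {i : Fin E.n | E.hg.IsThick (E.q i)}.ncard

end EA2Data

/-- The Gaussian binomial coefficient C(n, k)_2 with base 2, via the
q-Pascal recurrence C(n, k)_2 = C(n-1, k-1)_2 + 2^k · C(n-1, k)_2. -/
def gaussBinom2 : ℕ → ℕ → ℕ
  | _, 0 => 1
  | 0, _ + 1 => 0
  | n + 1, k + 1 => gaussBinom2 n k + 2 ^ (k + 1) * gaussBinom2 n (k + 1)

end HyperPaper

open HyperPaper

namespace HyperPaper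

namespace Hypergroup

variable {H : Type*} (hg : Hypergroup H)

theorem mem_smul {F G : Set H} {a : H} :
    a ∈ hg.smul F G ↔ ∃ b ∈ F, ∃ c ∈ G, a ∈ hg.hmul b c := Iff.rfl

theorem singleton_smul_singleton (a b : H) : hg.smul {a} {b} = hg.hmul a b := by
  ext x; simp [mem_smul]

theorem e_smul (F : Set H) : hg.smul {hg.e} F = F := by
  ext x; simp [mem_smul, hg.idl]

theorem smul_e (F : Set H) : hg.smul F {hg.e} = F := by
  ext x; simp [mem_smul, hg.idr]

theorem smul_assoc (A B C : Set H) :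
    hg.smul (hg.smul A B) C = hg.smul A (hg.smul B C) := by
  ext x
  constructor
  · rintro ⟨y, ⟨a, ha, b, hb, hy⟩, c, hc, hx⟩
    have h : x ∈ ⋃ y ∈ hg.hmul a b, hg.hmul y c := Set.mem_biUnion hy hx
    rw [hg.assoc] at h
    obtain ⟨z, hz, hxz⟩ := Set.mem_iUnion₂.1 h
    exact ⟨a, ha, z, ⟨b, hb, c, hc, hz⟩, hxz⟩
  · rintro ⟨a, ha, z, ⟨b, hb, c, hc, hz⟩, hx⟩
    have h : x ∈ ⋃ z ∈ hg.hmul b c, hg.hmul a z := Set.mem_biUnion hz hx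
    rw [← hg.assoc] at h
    obtain ⟨y, hy, hxy⟩ := Set.mem_iUnion₂.1 h
    exact ⟨y, ⟨a, ha, b, hb, hy⟩, c, hc, hxy⟩

theorem e_mem_star_mul (p : H) : hg.e ∈ hg.hmul (hg.star p) p :=
  (hg.h3r p p hg.e).1 (by simp [hg.idr])

theorem star_star (p : H) : hg.star (hg.star p) = p := by
  have h := (hg.h3r hg.e (hg.star p) p).1 (hg.e_mem_star_mul p)
  simpa [hg.idr, eq_comm] using h

theorem e_mem_mul_iff (p q : H) : hg.e ∈ hg.hmul p q ↔ p = hg.star q := by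
  rw [hg.h3l, hg.idl, Set.mem_singleton_iff]

theorem hmul_nonempty (p q : H) : (hg.hmul p q).Nonempty := by
  have h : p ∈ ⋃ x ∈ hg.hmul q (hg.star q), hg.hmul p x := by
    refine Set.mem_biUnion (x := hg.e) ?_ (by simp [hg.idr])
    rw [hg.e_mem_mul_iff, hg.star_star]
  rw [← hg.assoc] at h
  obtain ⟨y, hy, -⟩ := Set.mem_iUnion₂.1 h
  exact ⟨y, hy⟩

theorem listProd_singleton_nonempty {ι : Type*} (t : ι → H) (l : List ι) :
    (hg.listProd (l.map fun i => ({t i} : Set H))).Nonempty := by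
  induction l with
  | nil => exact ⟨_, rfl⟩
  | cons a l ih =>
    obtain ⟨y, hy⟩ := ih
    obtain ⟨z, hz⟩ := hg.hmul_nonempty (t a) y
    exact ⟨z, _, rfl, y, hy, hz⟩

theorem star_e : hg.star hg.e = hg.e :=
  ((hg.e_mem_mul_iff hg.e hg.e).1 (by simp [hg.idl])).symm

theorem isThin_e : hg.IsThin hg.e := by
  simp [IsThin, hg.star_e, hg.idl]

variable {hg}

theorem IsClosed.e_mem {G : Set H} (hG : hg.IsClosed G) : hg.e ∈ G := by
  obtain ⟨x, hx⟩ := hG.1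
  exact hG.2 ⟨_, ⟨x, hx, rfl⟩, x, hx, hg.e_mem_star_mul x⟩

theorem IsClosed.star_mem {G : Set H} (hG : hg.IsClosed G) {x : H} (hx : x ∈ G) :
    hg.star x ∈ G :=
  hG.2 ⟨_, ⟨x, hx, rfl⟩, hg.e, hG.e_mem, by simp [hg.idr]⟩

theorem IsClosed.mul_mem {G : Set H} (hG : hg.IsClosed G) {x y z : H} (hx : x ∈ G)
    (hy : y ∈ G) (hz : z ∈ hg.hmul x y) : z ∈ G :=
  hG.2 ⟨x, ⟨hg.star x, hG.star_mem hx, hg.star_star x⟩, y, hy, hz⟩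

variable (hg)

theorem subset_gen (F : Set H) : F ⊆ hg.gen F := fun _ hx _ hC => hC.2 hx

theorem gen_subset {F C : Set H} (hC : hg.IsClosed C) (h : F ⊆ C) : hg.gen F ⊆ C :=
  fun _ hx => hx C ⟨hC, h⟩

variable {hg}

theorem IsInvolution.gen_eq {p : H} (hp : hg.IsInvolution p) : hg.gen {p} = {hg.e, p} := by
  apply (hg.gen_subset hp.2 (by simp)).antisymm
  rintro x (rfl | rfl) C ⟨hC, hpC⟩
  · exact hC.e_mem
  · exact hpC rfl

theorem IsInvolution.star_eq {p : H} (hp : hg.IsInvolution p) : hg.star p = p := by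
  rcases hp.2.star_mem (x := p) (by simp) with h | h
  · exact absurd (by rw [← hg.star_star p, h, hg.star_e]) hp.1
  · exact h

theorem IsInvolution.mul_self_of_isThick {p : H} (hp : hg.IsInvolution p) (ht : hg.IsThick p) :
    p ∈ hg.hmul p p := by
  by_contra hn
  apply ht
  rw [IsThin, hp.star_eq]
  ext x
  constructor
  · intro hx
    rcases hp.2.mul_mem (x := p) (y := p) (by simp) (by simp) hx with h | h
    · exact h
    · rw [Set.mem_singleton_iff.1 h] at hx
      exact absurd hx hn
  · rintro rfl
    rw [hg.e_mem_mul_iff, hp.star_eq]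

variable (hg)

section ListProd

variable {ι : Type*}

theorem smul_listProd_comm (A : Set H) (f : ι → Set H) (l : List ι)
    (h : ∀ i ∈ l, hg.smul A (f i) = hg.smul (f i) A) :
    hg.smul A (hg.listProd (l.map f)) = hg.smul (hg.listProd (l.map f)) A := by
  induction l with
  | nil => simp [listProd, e_smul, smul_e]
  | cons a l ih =>
    simp only [List.map_cons, listProd]
    rw [← hg.smul_assoc, h a (by simp), hg.smul_assoc, ih fun i hi => h i (by simp [hi]),
      hg.smul_assoc]

theorem listProd_smul (f g : ι → Set H) (l : List ι) (hl : l.Nodup)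
    (h : ∀ i ∈ l, ∀ j ∈ l, i ≠ j → hg.smul (g i) (f j) = hg.smul (f j) (g i)) :
    hg.smul (hg.listProd (l.map f)) (hg.listProd (l.map g)) =
      hg.listProd (l.map fun i => hg.smul (f i) (g i)) := by
  induction l with
  | nil => simp [listProd, e_smul]
  | cons a l ih =>
    obtain ⟨hal, hl⟩ := List.nodup_cons.1 hl
    simp only [List.map_cons, listProd]
    rw [← ih hl fun i hi j hj => h i (by simp [hi]) j (by simp [hj]), hg.smul_assoc,
      ← hg.smul_assoc (hg.listProd (l.map f)), ← hg.smul_listProd_comm (g a) f l]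
    · simp only [hg.smul_assoc]
    · intro i hi
      exact h a (by simp) i (by simp [hi]) fun hai => hal (hai ▸ hi)

theorem listProd_eq_smul_filter [DecidableEq ι] (f : ι → Set H) (l : List ι) (hl : l.Nodup)
    (h : ∀ i j, i ≠ j → hg.smul (f i) (f j) = hg.smul (f j) (f i)) {i : ι} (hi : i ∈ l) :
    hg.listProd (l.map f) =
      hg.smul (f i) (hg.listProd ((l.filter fun j => decide (j ≠ i)).map f)) := by
  induction l with
  | nil => simp at hi
  | cons a l ih =>
    obtain ⟨hal, hl⟩ := List.nodup_cons.1 hl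
    by_cases hai : a = i
    · subst hai
      have : (a :: l).filter (fun j => decide (j ≠ a)) = l := by
        rw [List.filter_cons_of_neg (by simp), List.filter_eq_self]
        intro j hj
        simpa using fun hja : j = a => hal (hja ▸ hj)
      rw [this, List.map_cons, listProd]
    · have hil : i ∈ l := by
        rcases List.mem_cons.1 hi with h | h
        · exact absurd h.symm hai
        · exact h
      rw [List.filter_cons_of_pos (by simpa using hai)]
      simp only [List.map_cons, listProd]
      rw [ih hl hil, ← hg.smul_assoc, h a i hai, hg.smul_assoc]

theorem listProd_mono {f g : ι → Set H} (h : ∀ i, f i ⊆ g i) (l : List ι) :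
    hg.listProd (l.map f) ⊆ hg.listProd (l.map g) := by
  induction l with
  | nil => exact subset_rfl
  | cons a l ih =>
    rintro x ⟨b, hb, c, hc, hx⟩
    exact ⟨b, h a hb, c, ih hc, hx⟩

theorem mem_listProd_iff (f : ι → Set H) (hf : ∀ i, (f i).Nonempty) (l : List ι)
    (hl : l.Nodup) (x : H) :
    x ∈ hg.listProd (l.map f) ↔
      ∃ t : ι → H, (∀ i, t i ∈ f i) ∧ x ∈ hg.listProd (l.map fun i => ({t i} : Set H)) := by
  classical
  constructor
  · induction l generalizing x with
    | nil =>
      choose t ht using hf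
      exact fun hx => ⟨t, ht, hx⟩
    | cons a l ih =>
      obtain ⟨hal, hl⟩ := List.nodup_cons.1 hl
      rintro ⟨b, hb, c, hc, hx⟩
      obtain ⟨t, ht, hct⟩ := ih hl c hc
      refine ⟨Function.update t a b, fun i => ?_, b, ?_, c, ?_, hx⟩
      · by_cases hi : i = a
        · subst hi; simpa using hb
        · simpa [hi] using ht i
      · simp
      · convert hct using 2
        apply List.map_congr_left
        intro i hi
        rw [Function.update_of_ne fun hia : i = a => hal (hia ▸ hi)]
  · rintro ⟨t, ht, hx⟩
    exact hg.listProd_mono (fun i => Set.singleton_subset_iff.2 (ht i)) l hx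

end ListProd

end Hypergroup

namespace EA2Data

variable {H : Type*} (E : EA2Data H)

theorem fam_eq (i : Fin E.n) : E.fam i = {E.hg.e, E.q i} := (E.invol i).gen_eq

theorem e_mem_fam (i : Fin E.n) : E.hg.e ∈ E.fam i := by simp [fam_eq]

theorem q_mem_fam (i : Fin E.n) : E.q i ∈ E.fam i := by simp [fam_eq]

theorem isClosed_fam (i : Fin E.n) : E.hg.IsClosed (E.fam i) := by
  rw [fam_eq]; exact (E.invol i).2

theorem star_eq_of_mem_fam {i : Fin E.n} {a : H} (ha : a ∈ E.fam i) : E.hg.star a = a := by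
  rw [fam_eq] at ha
  rcases ha with rfl | rfl
  · exact E.hg.star_e
  · exact (E.invol i).star_eq

theorem mem_cofactor {i j : Fin E.n} (hij : j ≠ i) {a : H} (ha : a ∈ E.fam j) :
    a ∈ E.hg.cofactor E.fam i := by
  have key : ∀ l : List (Fin E.n), E.hg.e ∈ E.hg.listProd (l.map E.fam) := by
    intro l
    induction l with
    | nil => rfl
    | cons b l ih => exact ⟨_, E.e_mem_fam b, _, ih, by simp [E.hg.idl]⟩
  have : ∀ l : List (Fin E.n), j ∈ l → a ∈ E.hg.listProd (l.map E.fam) := by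
    intro l hl
    induction l with
    | nil => simp at hl
    | cons b l ih =>
      by_cases hb : j = b
      · subst hb
        exact ⟨a, ha, _, key l, by simp [E.hg.idr]⟩
      · exact ⟨_, E.e_mem_fam b, a, ih ((List.mem_cons.1 hl).resolve_left hb), by simp [E.hg.idl]⟩
  exact this _ (by simpa using hij)

theorem eq_e_of_mem_fam_of_mem_cofactor {i : Fin E.n} {a : H} (h1 : a ∈ E.fam i)
    (h2 : a ∈ E.hg.cofactor E.fam i) : a = E.hg.e := by
  have h : a ∈ E.fam i ∩ E.hg.cofactor E.fam i := ⟨h1, h2⟩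
  rw [show E.fam i ∩ E.hg.cofactor E.fam i = {E.hg.e} from E.dp.2.2 i] at h
  exact h

theorem q_injective : Function.Injective E.q := by
  intro i j hij
  by_contra hne
  exact (E.invol i).1 (E.eq_e_of_mem_fam_of_mem_cofactor (E.q_mem_fam i)
    (E.mem_cofactor (Ne.symm hne) (hij ▸ E.q_mem_fam j)))

theorem q_mul_comm_subset {i j : Fin E.n} (hij : i ≠ j) :
    E.hg.hmul (E.q i) (E.q j) ⊆ E.hg.hmul (E.q j) (E.q i) := by
  intro x hx
  have hn : E.hg.smul (E.fam i) {E.q j} = E.hg.smul {E.q j} (E.fam i) :=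
    (E.dp.1 i).2.2.2 _ trivial
  have h : x ∈ E.hg.smul {E.q j} (E.fam i) := hn ▸ ⟨_, E.q_mem_fam i, _, rfl, hx⟩
  obtain ⟨_, rfl, c, hc, h⟩ := h
  rw [fam_eq] at hc
  rcases hc with rfl | rfl
  · rw [E.hg.idr, Set.mem_singleton_iff] at h
    subst h
    have h1 := (E.hg.h3l _ _ _).1 hx
    have h2 : E.q i ∈ E.fam j :=
      (E.isClosed_fam j).mul_mem (E.q_mem_fam j) ((E.isClosed_fam j).star_mem (E.q_mem_fam j)) h1
    exact absurd (E.eq_e_of_mem_fam_of_mem_cofactor (E.q_mem_fam i) (E.mem_cofactor hij.symm h2))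
      (E.invol i).1
  · exact h

theorem smul_comm_of_mem_fam {i j : Fin E.n} (hij : i ≠ j) {a b : H} (ha : a ∈ E.fam i)
    (hb : b ∈ E.fam j) : E.hg.smul {a} {b} = E.hg.smul {b} {a} := by
  rw [fam_eq] at ha hb
  simp only [Hypergroup.singleton_smul_singleton]
  rcases ha with rfl | rfl
  · rw [E.hg.idl, E.hg.idr]
  · rcases hb with rfl | rfl
    · rw [E.hg.idl, E.hg.idr]
    · exact (E.q_mul_comm_subset hij).antisymm (E.q_mul_comm_subset hij.symm)

theorem exists_isDecomp (x : H) : ∃ r, E.hg.IsDecomp E.fam x r := by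
  have h : x ∈ E.hg.dcover E.fam x := by
    rw [show E.hg.dcover E.fam x = {x} from E.constrained x]; rfl
  obtain ⟨r, hr, -⟩ := h
  exact ⟨r, hr⟩

theorem famProd_eq_of_isDecomp {x : H} {r : Fin E.n → H} (h : E.hg.IsDecomp E.fam x r) :
    E.hg.famProd r = {x} := by
  have hc : E.hg.dcover E.fam x = {x} := E.constrained x
  apply Set.Subset.antisymm
  · intro y hy
    rw [← hc]
    exact ⟨r, h, hy⟩
  · rintro _ rfl
    exact h.2

theorem famProd_smul {r t : Fin E.n → H} (hr : ∀ i, r i ∈ E.fam i) (ht : ∀ i, t i ∈ E.fam i)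
    (z : H) : z ∈ E.hg.smul (E.hg.famProd r) (E.hg.famProd t) ↔
      ∃ u : Fin E.n → H, (∀ i, u i ∈ E.hg.hmul (r i) (t i)) ∧ z ∈ E.hg.famProd u := by
  rw [Hypergroup.famProd, Hypergroup.famProd, E.hg.listProd_smul _ _ _ (List.nodup_finRange _)
    fun i _ j _ hij => E.smul_comm_of_mem_fam hij (ht i) (hr j)]
  simp only [Hypergroup.singleton_smul_singleton]
  exact E.hg.mem_listProd_iff _ (fun i => E.hg.hmul_nonempty _ _) _ (List.nodup_finRange _) z

theorem e_mem_mul_self (x : H) : E.hg.e ∈ E.hg.hmul x x := by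
  obtain ⟨r, hr⟩ := E.exists_isDecomp x
  have h : E.hg.e ∈ E.hg.smul (E.hg.famProd r) (E.hg.famProd r) := by
    rw [E.famProd_smul hr.1 hr.1]
    refine ⟨fun _ => E.hg.e, fun i => ?_, ?_⟩
    · rw [E.hg.e_mem_mul_iff, E.star_eq_of_mem_fam (hr.1 i)]
    · rw [Hypergroup.famProd]
      generalize List.finRange E.n = l
      induction l with
      | nil => rfl
      | cons b l ih => exact ⟨_, rfl, _, ih, by simp [E.hg.idl]⟩
  rwa [E.famProd_eq_of_isDecomp hr, Hypergroup.singleton_smul_singleton] at h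

theorem star_eq (x : H) : E.hg.star x = x :=
  ((E.hg.e_mem_mul_iff x x).1 (E.e_mem_mul_self x)).symm

theorem eq_e_of_e_mem_famProd {u : Fin E.n → H} (hu : ∀ i, u i ∈ E.fam i)
    (h : E.hg.e ∈ E.hg.famProd u) (i : Fin E.n) : u i = E.hg.e := by
  rw [Hypergroup.famProd, E.hg.listProd_eq_smul_filter _ _ (List.nodup_finRange _)
    (fun j k hjk => E.smul_comm_of_mem_fam hjk (hu j) (hu k)) (List.mem_finRange i)] at h
  obtain ⟨_, rfl, y, hy, h⟩ := h
  rw [E.hg.e_mem_mul_iff, E.star_eq] at h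
  refine E.eq_e_of_mem_fam_of_mem_cofactor (hu i) ?_
  rw [h]
  exact E.hg.listProd_mono (fun j => Set.singleton_subset_iff.2 (hu j)) _ hy

theorem isDecomp_unique {x : H} {r t : Fin E.n → H} (hr : E.hg.IsDecomp E.fam x r)
    (ht : E.hg.IsDecomp E.fam x t) : r = t := by
  have h : E.hg.e ∈ E.hg.smul (E.hg.famProd r) (E.hg.famProd t) :=
    ⟨x, hr.2, x, ht.2, E.e_mem_mul_self x⟩
  obtain ⟨u, hu, hue⟩ := (E.famProd_smul hr.1 ht.1 _).1 h
  funext i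
  have hi := hu i
  rw [E.eq_e_of_e_mem_famProd
    (fun j => (E.isClosed_fam j).mul_mem (hr.1 j) (ht.1 j) (hu j)) hue i,
    E.hg.e_mem_mul_iff, E.star_eq] at hi
  exact hi

/-- The coordinates of `x` with respect to the family `⟨q_1⟩, …, ⟨q_n⟩`. -/
noncomputable def coord (x : H) : Fin E.n → H := (E.exists_isDecomp x).choose

theorem isDecomp_coord (x : H) : E.hg.IsDecomp E.fam x (E.coord x) :=
  (E.exists_isDecomp x).choose_spec

theorem coord_mem_fam (x : H) (i : Fin E.n) : E.coord x i ∈ E.fam i := (E.isDecomp_coord x).1 i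

theorem coord_eq (x : H) (i : Fin E.n) : E.coord x i = E.hg.e ∨ E.coord x i = E.q i := by
  have h := E.coord_mem_fam x i
  rw [fam_eq] at h
  exact h

theorem isDecomp_iff {x : H} {r : Fin E.n → H} : E.hg.IsDecomp E.fam x r ↔ r = E.coord x :=
  ⟨fun h => E.isDecomp_unique h (E.isDecomp_coord x), fun h => h ▸ E.isDecomp_coord x⟩

theorem mem_hmul_iff {x y z : H} :
    z ∈ E.hg.hmul x y ↔ ∀ i, E.coord z i ∈ E.hg.hmul (E.coord x i) (E.coord y i) := by
  rw [← Hypergroup.singleton_smul_singleton, ← E.famProd_eq_of_isDecomp (E.isDecomp_coord x),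
    ← E.famProd_eq_of_isDecomp (E.isDecomp_coord y),
    E.famProd_smul (E.coord_mem_fam x) (E.coord_mem_fam y)]
  constructor
  · rintro ⟨u, hu, hz⟩
    have : u = E.coord z := E.isDecomp_iff.1
      ⟨fun i => (E.isClosed_fam i).mul_mem (E.coord_mem_fam x i) (E.coord_mem_fam y i) (hu i), hz⟩
    exact this ▸ hu
  · exact fun h => ⟨_, h, (E.isDecomp_coord z).2⟩

/-- If coordinatewise products contain the entries of `u`, then so does the product of the
elements: there is `z ∈ xy` with coordinates `u`. -/
theorem exists_mem_hmul {x y : H} {u : Fin E.n → H}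
    (h : ∀ i, u i ∈ E.hg.hmul (E.coord x i) (E.coord y i)) :
    ∃ z ∈ E.hg.hmul x y, E.coord z = u := by
  have hu : ∀ i, u i ∈ E.fam i := fun i =>
    (E.isClosed_fam i).mul_mem (E.coord_mem_fam x i) (E.coord_mem_fam y i) (h i)
  obtain ⟨z, hz⟩ : (E.hg.famProd u).Nonempty := E.hg.listProd_singleton_nonempty u _
  have hz' : u = E.coord z := E.isDecomp_iff.1 ⟨hu, hz⟩
  exact ⟨z, E.mem_hmul_iff.2 (hz' ▸ h), hz'.symm⟩

theorem coord_injective : Function.Injective E.coord := by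
  intro x y h
  have h1 := E.famProd_eq_of_isDecomp (E.isDecomp_coord x)
  rw [h, E.famProd_eq_of_isDecomp (E.isDecomp_coord y)] at h1
  exact (Set.singleton_eq_singleton_iff.1 h1).symm

theorem mem_support_iff {x y : H} :
    y ∈ E.support x ↔ y ≠ E.hg.e ∧ ∃ i, E.coord x i = y := by
  simp [support, Hypergroup.dsupport, isDecomp_iff]

theorem coord_e (i : Fin E.n) : E.coord E.hg.e i = E.hg.e :=
  E.eq_e_of_e_mem_famProd (E.coord_mem_fam _) (E.isDecomp_coord _).2 i

theorem mem_thickIn_iff {G : Set H} {x : H} :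
    x ∈ E.ThickIn G ↔ x ∈ G ∧ ∀ i, E.coord x i ≠ E.hg.e → E.hg.IsThick (E.coord x i) := by
  simp only [ThickIn, Set.mem_ofPred_eq, mem_support_iff]
  refine and_congr_right fun _ => ⟨?_, fun h => Or.inr ?_⟩
  · rintro (rfl | h) i hi
    · exact absurd (E.coord_e i) hi
    · exact h _ ⟨hi, i, rfl⟩
  · rintro _ ⟨hy, i, rfl⟩
    exact h i hy

open Classical in
/-- The indices at which `x` has a thick coordinate. -/
noncomputable def thickIdx (x : H) : Finset (Fin E.n) :=
  Finset.univ.filter fun i => E.hg.IsThick (E.coord x i)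

theorem mem_thickIdx {x : H} {i : Fin E.n} : i ∈ E.thickIdx x ↔ E.hg.IsThick (E.coord x i) := by
  simp [thickIdx]

theorem not_isThick_e : ¬ E.hg.IsThick E.hg.e := fun h => h E.hg.isThin_e

theorem coord_eq_q_of_isThick {x : H} {i : Fin E.n} (h : E.hg.IsThick (E.coord x i)) :
    E.coord x i = E.q i :=
  (E.coord_eq x i).resolve_left fun he => E.not_isThick_e (he ▸ h)

theorem sElem_eq_card (x : H) : E.sElem x = (E.thickIdx x).card := by
  have h : {y ∈ E.support x | E.hg.IsThick y} = E.q '' E.thickIdx x := by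
    ext y
    simp only [Set.mem_ofPred_eq, mem_support_iff, Set.mem_image, Finset.mem_coe, mem_thickIdx]
    constructor
    · rintro ⟨⟨-, i, rfl⟩, ht⟩
      exact ⟨i, ht, (E.coord_eq_q_of_isThick ht).symm⟩
    · rintro ⟨i, hi, rfl⟩
      have hq := E.coord_eq_q_of_isThick hi
      exact ⟨⟨(E.invol i).1, i, hq⟩, hq ▸ hi⟩
  rw [sElem, h, Set.ncard_image_of_injective _ E.q_injective, Set.ncard_coe_finset]

theorem eq_of_thickIdx_eq {G : Set H} {x y : H} (hx : x ∈ E.ThickIn G) (hy : y ∈ E.ThickIn G)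
    (h : E.thickIdx x = E.thickIdx y) : x = y := by
  rw [mem_thickIn_iff] at hx hy
  apply E.coord_injective
  funext i
  by_cases hi : i ∈ E.thickIdx x
  · rw [E.coord_eq_q_of_isThick (E.mem_thickIdx.1 hi),
      E.coord_eq_q_of_isThick (E.mem_thickIdx.1 (h ▸ hi))]
  · have hi' : i ∉ E.thickIdx y := h ▸ hi
    rw [mem_thickIdx] at hi hi'
    rw [not_imp_comm.1 (hx.2 i) hi, not_imp_comm.1 (hy.2 i) hi']

theorem isClosed_of_mul_mem {G : Set H} (hne : G.Nonempty)
    (h : ∀ x ∈ G, ∀ y ∈ G, ∀ z ∈ E.hg.hmul x y, z ∈ G) : E.hg.IsClosed G := by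
  refine ⟨hne, ?_⟩
  rintro z ⟨_, ⟨x, hx, rfl⟩, y, hy, hz⟩
  rw [E.star_eq] at hz
  exact h x hx y hy z hz

theorem e_mem_thickIn {G : Set H} (hG : E.hg.IsClosed G) : E.hg.e ∈ E.ThickIn G :=
  ⟨hG.e_mem, Or.inl rfl⟩

theorem isClosed_thickIn {G : Set H} (hG : E.hg.IsClosed G) : E.hg.IsClosed (E.ThickIn G) := by
  refine E.isClosed_of_mul_mem ⟨_, E.e_mem_thickIn hG⟩ fun x hx y hy z hz => ?_
  rw [mem_thickIn_iff] at hx hy ⊢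
  refine ⟨hG.mul_mem hx.1 hy.1 hz, fun i hi => ?_⟩
  have hzi := (E.mem_hmul_iff.1 hz) i
  have hzq := (E.coord_eq z i).resolve_left hi
  rcases E.coord_eq x i with hxe | hxq
  · rw [hxe, E.hg.idl, Set.mem_singleton_iff] at hzi
    rw [hzi] at hi ⊢
    exact hy.2 i hi
  · rw [hzq, ← hxq]
    exact hx.2 i (hxq ▸ (E.invol i).1)

/-- The externally thick part of an element of a closed subset lies in that subset. -/
theorem exists_mem_thickIn_thickIdx_eq {G : Set H} (hG : E.hg.IsClosed G) {x : H} (hx : x ∈ G) :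
    ∃ y ∈ E.ThickIn G, E.thickIdx y = E.thickIdx x := by
  classical
  obtain ⟨y, hy, hyc⟩ := E.exists_mem_hmul (x := x) (y := x)
    (u := fun i => if E.hg.IsThick (E.coord x i) then E.coord x i else E.hg.e) (by
      intro i
      split_ifs with h
      · have hq := E.coord_eq_q_of_isThick h
        rw [hq] at h ⊢
        exact (E.invol i).mul_self_of_isThick h
      · exact E.e_mem_mul_self _)
  refine ⟨y, E.mem_thickIn_iff.2 ⟨hG.mul_mem hx hx hy, fun i hi => ?_⟩, ?_⟩
  · rw [hyc] at hi ⊢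
    dsimp only at hi ⊢
    split_ifs at hi ⊢ with h
    · exact h
    · exact absurd rfl hi
  · ext i
    rw [mem_thickIdx, mem_thickIdx, hyc]
    dsimp only
    split_ifs with h
    · rfl
    · exact iff_of_false E.not_isThick_e h

theorem exists_mem_thickIn_thickIdx_eq_union {G : Set H} (hG : E.hg.IsClosed G) {x y : H}
    (hx : x ∈ E.ThickIn G) (hy : y ∈ E.ThickIn G) :
    ∃ z ∈ E.ThickIn G, E.thickIdx z = E.thickIdx x ∪ E.thickIdx y := by
  classical
  obtain ⟨z, hz, hzc⟩ := E.exists_mem_hmul (x := x) (y := y)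
    (u := fun i => if E.coord x i = E.hg.e then E.coord y i else E.coord x i) (by
      intro i
      split_ifs with h
      · rw [h, E.hg.idl]; rfl
      · rcases E.coord_eq y i with hye | hyq
        · rw [hye, E.hg.idr]; rfl
        · have ht := (E.mem_thickIn_iff.1 hx).2 i h
          have hxq := E.coord_eq_q_of_isThick ht
          rw [hxq] at ht
          rw [hxq, hyq]
          exact (E.invol i).mul_self_of_isThick ht)
  refine ⟨z, (E.isClosed_thickIn hG).mul_mem hx hy hz, ?_⟩
  ext i
  rw [Finset.mem_union, mem_thickIdx, mem_thickIdx, mem_thickIdx, hzc]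
  dsimp only
  split_ifs with h
  · rw [h]
    simp [E.not_isThick_e]
  · simp [(E.mem_thickIn_iff.1 hx).2 i h]

theorem mem_mul_self_of_thickIdx_subset {G : Set H} {r x : H}
    (hx : x ∈ E.ThickIn G) (h : E.thickIdx x ⊆ E.thickIdx r) : x ∈ E.hg.hmul r r := by
  rw [mem_hmul_iff]
  intro i
  by_cases hxi : E.coord x i = E.hg.e
  · rw [hxi]
    exact E.e_mem_mul_self _
  · have hxt := (E.mem_thickIn_iff.1 hx).2 i hxi
    have hrt := E.mem_thickIdx.1 (h (E.mem_thickIdx.2 hxt))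
    have hxq := E.coord_eq_q_of_isThick hxt
    rw [hxq] at hxt ⊢
    rw [E.coord_eq_q_of_isThick hrt]
    exact (E.invol i).mul_self_of_isThick hxt

theorem exists_thickIdx_maximum {G : Set H} (hG : E.hg.IsClosed G) :
    ∃ r ∈ E.ThickIn G, ∀ x ∈ E.ThickIn G, E.thickIdx x ⊆ E.thickIdx r := by
  obtain ⟨_, ⟨r, hr, rfl⟩, hmax⟩ := Set.exists_max_image (E.thickIdx '' E.ThickIn G) Finset.card
    (Set.toFinite _) ⟨_, _, E.e_mem_thickIn hG, rfl⟩
  refine ⟨r, hr, fun x hx => ?_⟩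
  obtain ⟨z, hz, hzu⟩ := E.exists_mem_thickIn_thickIdx_eq_union hG hr hx
  have hcard := hmax _ ⟨z, hz, rfl⟩
  rw [hzu] at hcard
  rw [Finset.eq_of_subset_of_card_le Finset.subset_union_left hcard]
  exact Finset.subset_union_right

end EA2Data

end HyperPaper

/-- For a closed subset G of an elementary abelian 2-hypergroup there
is a unique r ∈ G with Thick(G) = ⟨r⟩ and s(G) = s(r). -/
theorem stmt4 {H : Type*} (E : EA2Data H) (G : Set H) (hG : E.hg.IsClosed G) :
    ∃! r : H, r ∈ G ∧ E.ThickIn G = E.hg.gen {r} ∧ E.sSet G = E.sElem r := by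
  obtain ⟨r, hr, hmax⟩ := E.exists_thickIdx_maximum hG
  have hs : E.sSet G = E.sElem r := by
    apply IsGreatest.csSup_eq
    refine ⟨⟨r, hr.1, rfl⟩, ?_⟩
    rintro _ ⟨x, hx, rfl⟩
    obtain ⟨y, hy, hyx⟩ := E.exists_mem_thickIn_thickIdx_eq hG hx
    rw [E.sElem_eq_card, E.sElem_eq_card, ← hyx]
    exact Finset.card_le_card (hmax y hy)
  refine ⟨r, ⟨hr.1, Set.Subset.antisymm ?_ ?_, hs⟩, ?_⟩
  · rintro x hx C ⟨hC, hrC⟩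
    exact hC.mul_mem (hrC rfl) (hrC rfl) (E.mem_mul_self_of_thickIdx_subset hx (hmax x hx))
  · exact E.hg.gen_subset (E.isClosed_thickIn hG) (Set.singleton_subset_iff.2 hr)
  · rintro t ⟨-, htG, hts⟩
    have ht : t ∈ E.ThickIn G := htG ▸ E.hg.subset_gen {t} rfl
    refine E.eq_of_thickIdx_eq ht hr (Finset.eq_of_subset_of_card_le (hmax t ht) ?_)
    rw [← E.sElem_eq_card, ← E.sElem_eq_card, ← hs, ← hts]
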